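/- arXiv:1909.11577 — 3 statements merged into one kernel-verified Lean document; each statement's English description precedes it below -/
import Mathlib

section
/- Let T be a string of length n and let P = T[a..b] be a periodic fragment, i.e., p := per(T[a..b]) satisfies 2p ≤ b-a+1. Then there exists exactly one pair (a',b') with 1 ≤ a' ≤ a ≤ b ≤ b' ≤ n such that: p is a period of T[a'..b']; if a' > 1 then T[a'-1] ≠ T[a'+p-1]; and if b' < n then T[b'-p+1] ≠ T[b'+1]. Moreover, for this pair, per(T[a'..b']) = p; that is, T[a'..b'] is the unique run of T containing T[a..b] whose period equals per(P). -/
/-- `p` is a period of the fragment `S[a..b]` (1-indexed, inclusive). -/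
def FragPeriod {α : Type*} (S : ℕ → α) (a b p : ℕ) : Prop :=
  1 ≤ p ∧ p ≤ b + 1 - a ∧ ∀ x, a ≤ x → x + p ≤ b → S x = S (x + p)

/-- `q = (a', b')` delimits a fragment `T[a'..b']` extending `T[a..b]`, having period `p`,
which can be extended neither to the left nor to the right keeping the period `p`. -/
def RunExt {α : Type*} (T : ℕ → α) (n a b p : ℕ) (q : ℕ × ℕ) : Prop :=
  1 ≤ q.1 ∧ q.1 ≤ a ∧ b ≤ q.2 ∧ q.2 ≤ n ∧
  FragPeriod T q.1 q.2 p ∧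
  (1 < q.1 → T (q.1 - 1) ≠ T (q.1 + p - 1)) ∧
  (q.2 < n → T (q.2 - p + 1) ≠ T (q.2 + 1))

theorem FragPeriod.mono {α : Type*} {S : ℕ → α} {a b a' b' p : ℕ}
    (h : FragPeriod S a' b' p) (ha : a' ≤ a) (hb : b ≤ b') (hp : p ≤ b + 1 - a) :
    FragPeriod S a b p :=
  ⟨h.1, hp, fun x hx hxb => h.2.2 x (ha.trans hx) (hxb.trans hb)⟩

theorem RunExt.fst_le {α : Type*} {T : ℕ → α} {n a b p : ℕ} {q r : ℕ × ℕ}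
    (hp : p ≤ b + 1 - a) (hq : RunExt T n a b p q) (hr : RunExt T n a b p r) :
    q.1 ≤ r.1 := by
  obtain ⟨hq1, hqa, -, -, -, hql, -⟩ := hq
  obtain ⟨hr1, -, hrb, -, ⟨hp1, -, hr⟩, -, -⟩ := hr
  by_contra! hlt
  refine hql (by omega) ?_
  rw [hr (q.1 - 1) (by omega) (by omega)]
  congr 1
  omega

theorem RunExt.le_snd {α : Type*} {T : ℕ → α} {n a b p : ℕ} {q r : ℕ × ℕ}
    (hp : p ≤ b + 1 - a) (hq : RunExt T n a b p q) (hr : RunExt T n a b p r) :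
    r.2 ≤ q.2 := by
  obtain ⟨-, -, hqb, -, -, -, hqr⟩ := hq
  obtain ⟨hr1, hra, -, hrn, ⟨hp1, -, hr⟩, -, -⟩ := hr
  by_contra! hlt
  refine hqr (by omega) ?_
  rw [hr (q.2 - p + 1) (by omega) (by omega)]
  congr 1
  omega

theorem FragPeriod.exists_runExt {α : Type*} {T : ℕ → α} {n a b p : ℕ}
    (ha : 1 ≤ a) (hb : b ≤ n) (h : FragPeriod T a b p) :
    ∃ q : ℕ × ℕ, RunExt T n a b p q := by
  classical
  obtain ⟨hp1, hp, hper⟩ := h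
  have hL : ∃ c, 1 ≤ c ∧ c ≤ a ∧ ∀ x, c ≤ x → x < a → T x = T (x + p) :=
    ⟨a, ha, le_rfl, fun x _ _ => by omega⟩
  obtain ⟨hc1, hca, hc⟩ := Nat.find_spec hL
  have hcmin := fun m => Nat.find_min (m := m) hL
  generalize Nat.find hL = c at hc1 hca hc hcmin
  let R : ℕ → Prop := fun d => ∀ x, a ≤ x → x + p ≤ d → T x = T (x + p)
  have hd : R (Nat.findGreatest R n) := Nat.findGreatest_spec hb hper
  have hbd : b ≤ Nat.findGreatest R n := Nat.le_findGreatest hb hper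
  have hdn : Nat.findGreatest R n ≤ n := Nat.findGreatest_le n
  have hdmax := fun k => Nat.findGreatest_is_greatest (P := R) (n := n) (k := k)
  generalize Nat.findGreatest R n = d at hd hbd hdn hdmax
  refine ⟨(c, d), hc1, hca, hbd, hdn, ⟨hp1, by dsimp only; omega, fun x hx hxd => ?_⟩, ?_, ?_⟩
  · rcases lt_or_ge x a with hxa | hxa
    · exact hc x hx hxa
    · exact hd x hxa hxd
  · intro h1 heq
    dsimp only at h1 heq
    refine hcmin (c - 1) (by omega) ⟨by omega, by omega, fun x hx hxa => ?_⟩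
    rcases eq_or_lt_of_le hx with rfl | hlt
    · rw [heq]
      congr 1
      omega
    · exact hc x (by omega) hxa
  · intro h1 heq
    dsimp only at h1 heq
    refine hdmax (d + 1) (by omega) (by omega) fun x hxa hxd => ?_
    rcases eq_or_lt_of_le hxd with hx | hlt
    · rw [hx, ← heq]
      congr 1
      omega
    · exact hd x hxa (by omega)

/-- Every periodic fragment `T[a..b]` (with smallest period `p`, `2p ≤ b - a + 1`) extends
to a unique run `T[a'..b']`, and this run has smallest period exactly `p`. -/
theorem statement2 {α : Type*} (T : ℕ → α) (n a b p : ℕ)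
    (ha : 1 ≤ a) (hab : a ≤ b) (hb : b ≤ n)
    (hper : IsLeast {q | FragPeriod T a b q} p)
    (hperiodic : 2 * p ≤ b + 1 - a) :
    (∃! q : ℕ × ℕ, RunExt T n a b p q) ∧
    (∀ q : ℕ × ℕ, RunExt T n a b p q →
      IsLeast {p' | FragPeriod T q.1 q.2 p'} p) := by
  have hp := hper.1.2.1
  refine ⟨?_, fun q hq => ⟨hq.2.2.2.2.1, fun p' hp' => ?_⟩⟩
  · obtain ⟨q, hq⟩ := hper.1.exists_runExt ha hb
    exact ⟨q, hq, fun r hr => Prod.ext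
      ((hr.fst_le hp hq).antisymm (hq.fst_le hp hr))
      ((hq.le_snd hp hr).antisymm (hr.le_snd hp hq))⟩
  · by_contra! hlt
    exact hlt.not_ge (hper.2 (FragPeriod.mono hp' hq.2.1 hq.2.2.1 (hlt.le.trans hp)))
end

section
/- Let Q be a nonempty string with smallest period p = per(Q), and let P be a string with p ≤ |P| ≤ |Q| that occurs in Q (at some position). Then there is exactly one position i with 1 ≤ i ≤ p such that P occurs in Q at position i. -/
/-- The string `P` of length `m` (1-indexed) occurs in the string `Q` of length `nQ`
at position `i`, i.e. `Q[i..i+m-1] = P`. -/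
def OccursAt {α : Type*} (Q : ℕ → α) (nQ : ℕ) (P : ℕ → α) (m i : ℕ) : Prop :=
  1 ≤ i ∧ i + m - 1 ≤ nQ ∧ ∀ x, 1 ≤ x → x ≤ m → Q (i + x - 1) = P x

theorem FragPeriod.eq_add_mul {α : Type*} {S : ℕ → α} {a b p : ℕ} (h : FragPeriod S a b p)
    {x : ℕ} (hx : a ≤ x) (k : ℕ) (hk : x + p * k ≤ b) : S x = S (x + p * k) := by
  induction k with
  | zero => simp
  | succ k ih =>
    rw [Nat.mul_succ, ← Nat.add_assoc] at hk ⊢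
    rw [ih (by omega), h.2.2 _ (by omega) hk]

theorem FragPeriod.eq_of_modEq {α : Type*} {S : ℕ → α} {a b p : ℕ} (h : FragPeriod S a b p)
    {x y : ℕ} (hx : a ≤ x) (hxb : x ≤ b) (hy : a ≤ y) (hyb : y ≤ b) (hxy : x ≡ y [MOD p]) :
    S x = S y := by
  wlog hle : x ≤ y generalizing x y
  · exact (this hy hyb hx hxb hxy.symm (by omega)).symm
  obtain ⟨k, hk⟩ := (Nat.modEq_iff_dvd' hle).1 hxy
  obtain rfl : y = x + p * k := by omega
  exact h.eq_add_mul hx k hyb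

theorem Nat.exists_modEq_mem_Ico {p : ℕ} (hp : 0 < p) {i : ℕ} (hi : i ≤ p) (y : ℕ) :
    ∃ z, i ≤ z ∧ z < i + p ∧ z ≡ y [MOD p] := by
  have hr := Nat.mod_lt y hp
  by_cases h : i ≤ y % p
  · exact ⟨y % p, h, by omega, Nat.mod_modEq y p⟩
  · exact ⟨y % p + p, by omega, by omega, by simp [Nat.ModEq]⟩

theorem OccursAt.exists_le_period {α : Type*} {Q P : ℕ → α} {nQ m p j : ℕ}
    (hp : FragPeriod Q 1 nQ p) (h : OccursAt Q nQ P m j) :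
    ∃ i, 1 ≤ i ∧ i ≤ p ∧ OccursAt Q nQ P m i := by
  induction j using Nat.strong_induction_on with
  | _ j ih =>
    by_cases hjp : j ≤ p
    · exact ⟨j, h.1, hjp, h⟩
    · obtain ⟨hj, hjm, hP⟩ := h
      have hp1 := hp.1
      refine ih (j - p) (by omega) ⟨by omega, by omega, fun x hx hxm => ?_⟩
      rw [← hP x hx hxm, hp.2.2 (j - p + x - 1) (by omega) (by omega)]
      congr 1
      omega

theorem OccursAt.not_lt_of_le_period {α : Type*} {Q P : ℕ → α} {nQ m p i j : ℕ}
    (hp : IsLeast {q | FragPeriod Q 1 nQ q} p) (hpm : p ≤ m)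
    (hi : OccursAt Q nQ P m i) (hj : OccursAt Q nQ P m j) (hjp : j ≤ p) : ¬ i < j := by
  intro hij
  obtain ⟨hi1, him, hiP⟩ := hi
  obtain ⟨hj1, hjm, hjP⟩ := hj
  obtain ⟨hper, hmin⟩ := hp
  have hp1 := hper.1
  have hpn := hper.2.1
  have hd : FragPeriod Q 1 nQ (j - i) := by
    refine ⟨by omega, by omega, fun y hy hyn => ?_⟩
    obtain ⟨z, hiz, hzi, hzy⟩ := Nat.exists_modEq_mem_Ico hp1 (hij.le.trans hjp) y
    have hQz : Q z = Q (z + (j - i)) := by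
      have h1 := hiP (z - i + 1) (by omega) (by omega)
      have h2 := hjP (z - i + 1) (by omega) (by omega)
      rw [show i + (z - i + 1) - 1 = z by omega] at h1
      rw [show j + (z - i + 1) - 1 = z + (j - i) by omega] at h2
      rw [h1, h2]
    calc
      Q y = Q z := hper.eq_of_modEq hy (by omega) (by omega) (by omega) hzy.symm
      _ = Q (z + (j - i)) := hQz
      _ = Q (y + (j - i)) :=
        hper.eq_of_modEq (by omega) (by omega) (by omega) hyn (hzy.add_right _)
  have := hmin hd
  omega

/-- If a pattern `P` with `per(Q) ≤ |P| ≤ |Q|` occurs in `Q`, then `P` has exactly one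
occurrence in the first `per(Q)` positions of `Q`. -/
theorem statement3 {α : Type*} (Q P : ℕ → α) (nQ m p : ℕ)
    (hQ : 1 ≤ nQ)
    (hper : IsLeast {q | FragPeriod Q 1 nQ q} p)
    (hpm : p ≤ m) (hmn : m ≤ nQ)
    (hocc : ∃ j, OccursAt Q nQ P m j) :
    ∃! i, 1 ≤ i ∧ i ≤ p ∧ OccursAt Q nQ P m i := by
  obtain ⟨j, hj⟩ := hocc
  obtain ⟨i, hi1, hip, hi⟩ := hj.exists_le_period hper.1
  refine ⟨i, ⟨hi1, hip, hi⟩, fun k ⟨_, hkp, hk⟩ => ?_⟩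
  exact le_antisymm (not_lt.1 (hi.not_lt_of_le_period hper hpm hk hkp))
    (not_lt.1 (hk.not_lt_of_le_period hper hpm hi hip))
end

section
/- Let R₁ = T[a₁..b₁] and R₂ = T[a₂..b₂] be two distinct runs of a string T, with smallest periods p₁ = per(R₁) and p₂ = per(R₂). Then the number of positions shared by the two runs satisfies |[a₁..b₁] ∩ [a₂..b₂]| < p₁ + p₂. -/
/-- `T[a..b]` is a run of the string `T` of length `n` with smallest period `p`:
`p = per(T[a..b]) ≤ (b - a + 1)/2`, and the fragment is maximal, i.e.
`T[a-1] ≠ T[a+p-1]` whenever `a > 1` and `T[b-p+1] ≠ T[b+1]` whenever `b < n`. -/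
def IsRunWith {α : Type*} (T : ℕ → α) (n a b p : ℕ) : Prop :=
  1 ≤ a ∧ a ≤ b ∧ b ≤ n ∧
  IsLeast {q | FragPeriod T a b q} p ∧
  2 * p ≤ b + 1 - a ∧
  (1 < a → T (a - 1) ≠ T (a + p - 1)) ∧
  (b < n → T (b - p + 1) ≠ T (b + 1))

/-- A step-`p` periodicity on `[l..r]` identifies all positions congruent modulo `p`. -/
lemma eq_of_modEq_of_step {α : Type*} {T : ℕ → α} {l r p : ℕ}
    (h : ∀ x, l ≤ x → x + p ≤ r → T x = T (x + p)) :
    ∀ x y, l ≤ x → x ≤ r → l ≤ y → y ≤ r → x ≡ y [MOD p] → T x = T y := by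
  have step : ∀ k x, l ≤ x → x + p * k ≤ r → T x = T (x + p * k) := by
    intro k
    induction k with
    | zero => intro x _ _; simp
    | succ k ih =>
      intro x hx hk
      rw [Nat.mul_succ, ← Nat.add_assoc] at hk ⊢
      rw [ih x hx (by omega)]
      exact h _ (by omega) hk
  have le : ∀ x y, l ≤ x → y ≤ r → x ≤ y → x ≡ y [MOD p] → T x = T y := by
    intro x y hx hy hxy hmod
    obtain ⟨k, hk⟩ := (Nat.modEq_iff_dvd' hxy).1 hmod
    obtain rfl : y = x + p * k := by omega
    exact step k x hx hy
  intro x y hx hx' hy hy' hmod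
  rcases le_total x y with hxy | hxy
  · exact le x y hx hy' hxy hmod
  · exact (le y x hy hx' hxy hmod.symm).symm

/-- Every residue class modulo `p` meets every interval of length at least `p`. -/
lemma exists_modEq_mem_interval {l r p : ℕ} (hp : 0 < p) (hlen : l + p ≤ r + 1) (x : ℕ) :
    ∃ y, l ≤ y ∧ y ≤ r ∧ y ≡ x [MOD p] := by
  refine ⟨l + (x + (p - 1) * l) % p, by omega, ?_, ?_⟩
  · have := Nat.mod_lt (x + (p - 1) * l) hp
    omega
  · have h : l + (x + (p - 1) * l) % p ≡ l + (x + (p - 1) * l) [MOD p] :=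
      Nat.ModEq.add_left _ (Nat.mod_modEq _ _)
    refine h.trans ?_
    obtain ⟨m, rfl⟩ : ∃ m, p = m + 1 := ⟨p - 1, by omega⟩
    have e : l + (x + (m + 1 - 1) * l) = x + (m + 1) * l := by
      rw [Nat.add_sub_cancel]; ring
    rw [e]
    simp [Nat.ModEq]

/-- If `T` has period `p` on `[a..b]` and a period `g` dividing `p` on a subinterval `[l..r]` of
length at least `p`, then `g` is a period on all of `[a..b]`. -/
lemma eq_of_modEq_of_dvd {α : Type*} {T : ℕ → α} {a b l r p g : ℕ} (hp : 0 < p)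
    (h : ∀ x, a ≤ x → x + p ≤ b → T x = T (x + p)) (hal : a ≤ l) (hrb : r ≤ b)
    (hlen : l + p ≤ r + 1) (hg : g ∣ p)
    (hT : ∀ x y, l ≤ x → x ≤ r → l ≤ y → y ≤ r → x ≡ y [MOD g] → T x = T y) :
    ∀ x y, a ≤ x → x ≤ b → a ≤ y → y ≤ b → x ≡ y [MOD g] → T x = T y := by
  intro x y hx hx' hy hy' hmod
  obtain ⟨u, hu, hu', hux⟩ := exists_modEq_mem_interval hp hlen x
  obtain ⟨v, hv, hv', hvy⟩ := exists_modEq_mem_interval hp hlen y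
  have hp' := eq_of_modEq_of_step h
  rw [← hp' u x (by omega) (by omega) hx hx' hux, ← hp' v y (by omega) (by omega) hy hy' hvy]
  exact hT u v hu hu' hv hv' (((hux.of_dvd hg).trans hmod).trans (hvy.of_dvd hg).symm)

/-- The weak periodicity lemma of Fine and Wilf. -/
lemma eq_of_modEq_gcd {α : Type*} {T : ℕ → α} {l r p q : ℕ} (hp0 : 0 < p) (hq0 : 0 < q)
    (hp : ∀ x, l ≤ x → x + p ≤ r → T x = T (x + p))
    (hq : ∀ x, l ≤ x → x + q ≤ r → T x = T (x + q)) (hlen : l + p + q ≤ r + 1) :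
    ∀ x y, l ≤ x → x ≤ r → l ≤ y → y ≤ r → x ≡ y [MOD p.gcd q] → T x = T y := by
  induction hn : p + q using Nat.strong_induction_on generalizing p q r with
  | _ n ih =>
  wlog hpq : p ≤ q generalizing p q
  · rw [Nat.gcd_comm]
    exact this hq0 hp0 hq hp (by omega) (by omega) (by omega)
  rcases hpq.eq_or_lt with rfl | hlt
  · rw [Nat.gcd_self]
    exact eq_of_modEq_of_step hp
  · refine eq_of_modEq_of_dvd hp0 hp le_rfl (Nat.sub_le r p) (by omega) (Nat.gcd_dvd_left p q) ?_
    rw [← Nat.gcd_sub_self_right hpq]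
    refine ih (p + (q - p)) (by omega) hp0 (by omega) (fun x hx hx' => hp x hx (by omega))
      (fun x hx hx' => ?_) (by omega) rfl
    rw [hq x hx (by omega), hp (x + (q - p)) (by omega) (by omega)]
    congr 1
    omega

/-- A smallest period of `T[a..b]` divides every `q` which is a period on a subinterval of length
at least `p + q`. -/
lemma dvd_of_isLeast_fragPeriod {α : Type*} {T : ℕ → α} {a b l r p q : ℕ}
    (h : IsLeast {q | FragPeriod T a b q} p) (hq0 : 0 < q)
    (hq : ∀ x, l ≤ x → x + q ≤ r → T x = T (x + q)) (hal : a ≤ l) (hrb : r ≤ b)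
    (hlen : l + p + q ≤ r + 1) : p ∣ q := by
  obtain ⟨⟨hp0, hpb, hp⟩, hmin⟩ := h
  have hgcd := eq_of_modEq_of_dvd hp0 hp hal hrb (by omega) (Nat.gcd_dvd_left p q)
    (eq_of_modEq_gcd hp0 hq0 (fun x hx hx' => hp x (by omega) (by omega)) hq hlen)
  have hle : p.gcd q ≤ p := Nat.gcd_le_left q hp0
  have hg : FragPeriod T a b (p.gcd q) :=
    ⟨Nat.gcd_pos_of_pos_left q hp0, hle.trans hpb, fun x hx hx' =>
      hgcd x _ hx (by omega) (by omega) hx' (by simp [Nat.ModEq])⟩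
  exact Nat.gcd_eq_left_iff_dvd.1 (le_antisymm hle (hmin hg))

/-- Two distinct runs `T[a₁..b₁]` and `T[a₂..b₂]` with smallest periods `p₁` and `p₂`
share fewer than `p₁ + p₂` positions. -/
theorem statement6 {α : Type*} (T : ℕ → α) (n a₁ b₁ a₂ b₂ p₁ p₂ : ℕ)
    (h₁ : IsRunWith T n a₁ b₁ p₁) (h₂ : IsRunWith T n a₂ b₂ p₂)
    (hne : (a₁, b₁) ≠ (a₂, b₂)) :
    (Finset.Icc a₁ b₁ ∩ Finset.Icc a₂ b₂).card < p₁ + p₂ := by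
  by_contra! hcard
  obtain ⟨ha₁, -, hb₁, hl₁, -, hL₁, hR₁⟩ := h₁
  obtain ⟨ha₂, -, hb₂, hl₂, -, hL₂, hR₂⟩ := h₂
  obtain ⟨hp₁, -, hs₁⟩ := hl₁.1
  obtain ⟨hp₂, -, hs₂⟩ := hl₂.1
  have hIcc : Finset.Icc a₁ b₁ ∩ Finset.Icc a₂ b₂ = Finset.Icc (a₁ ⊔ a₂) (b₁ ⊓ b₂) := by
    ext x
    simp only [Finset.mem_inter, Finset.mem_Icc]
    omega
  rw [hIcc, Nat.card_Icc] at hcard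
  obtain ⟨l, hl⟩ : ∃ l, l = a₁ ⊔ a₂ := ⟨_, rfl⟩
  obtain ⟨r, hr⟩ : ∃ r, r = b₁ ⊓ b₂ := ⟨_, rfl⟩
  rw [← hl, ← hr] at hcard
  have h₁₂ : p₁ ∣ p₂ := dvd_of_isLeast_fragPeriod hl₁ hp₂
    (fun x (hx : l ≤ x) (hx' : x + p₂ ≤ r) => hs₂ x (by omega) (by omega))
    (by omega) (by omega) (by omega)
  have h₂₁ : p₂ ∣ p₁ := dvd_of_isLeast_fragPeriod hl₂ hp₁
    (fun x (hx : l ≤ x) (hx' : x + p₁ ≤ r) => hs₁ x (by omega) (by omega))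
    (by omega) (by omega) (by omega)
  obtain rfl := Nat.dvd_antisymm h₁₂ h₂₁
  have left_eq : ∀ {a b c : ℕ}, (∀ x, a ≤ x → x + p₁ ≤ b → T x = T (x + p₁)) → a < c →
      c + p₁ ≤ b + 1 → T (c - 1) = T (c + p₁ - 1) := by
    intro a b c h hac hcb
    rw [h (c - 1) (by omega) (by omega)]
    congr 1
    omega
  have right_eq : ∀ {a b c : ℕ}, (∀ x, a ≤ x → x + p₁ ≤ b → T x = T (x + p₁)) → 1 ≤ a →
      c < b → a + p₁ ≤ c + 1 → T (c - p₁ + 1) = T (c + 1) := by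
    intro a b c h ha hcb hac
    rw [h (c - p₁ + 1) (by omega) (by omega)]
    congr 1
    omega
  have ha : a₁ = a₂ := by
    rcases lt_trichotomy a₁ a₂ with h | h | h
    · exact absurd (left_eq hs₁ h (by omega)) (hL₂ (by omega))
    · exact h
    · exact absurd (left_eq hs₂ h (by omega)) (hL₁ (by omega))
  have hb : b₁ = b₂ := by
    rcases lt_trichotomy b₁ b₂ with h | h | h
    · exact absurd (right_eq hs₂ ha₂ h (by omega)) (hR₁ (by omega))
    · exact h
    · exact absurd (right_eq hs₁ ha₁ h (by omega)) (hR₂ (by omega))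
  exact hne (by rw [ha, hb])
end
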